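/- Let k be a field and R a nonzero commutative k-algebra. Let X and Y be schemes of finite type over k, with X reduced and Y separated over k, and let Σ be a set of k-points of X (morphisms Spec k → X over k) whose images form a Zariski-dense subset of the topological space of X. Write X_R = X ×_{Spec k} Spec R and Y_R = Y ×_{Spec k} Spec R for the base changes, and for a k-point s of X write s_R : Spec R → X_R for its base change. Then a morphism of R-schemes φ : X_R → Y_R arises by base change from a morphism of k-schemes X → Y if and only if for every s ∈ Σ the R-point φ ∘ s_R of Y_R arises by base change from a k-point of Y (i.e., φ(Σ) ⊆ Y(k)). -/

import Mathlib

open CategoryTheory CategoryTheory.Limits AlgebraicGeometry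

open scoped TensorProduct

universe u

theorem tensorProduct_eq_zero_of_forall_lift_eq_zero {k A B : Type*} [Field k] [CommRing A]
    [CommRing B] [Algebra k A] [Algebra k B] (S : Set (B →ₐ[k] k))
    (hS : ∀ b : B, (∀ s ∈ S, s b = 0) → b = 0) (z : B ⊗[k] A)
    (hz : ∀ s ∈ S, Algebra.TensorProduct.lift ((Algebra.ofId k A).comp s) (AlgHom.id k A)
      (fun _ _ ↦ .all _ _) z = 0) : z = 0 := by
  let bA := Module.Basis.ofVectorSpace k A
  have key (s : B →ₐ[k] k) (i) (z : B ⊗[k] A) :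
      s ((Algebra.TensorProduct.basis B bA).repr z i) =
        bA.repr (Algebra.TensorProduct.lift ((Algebra.ofId k A).comp s) (AlgHom.id k A)
          (fun _ _ ↦ .all _ _) z) i := by
    induction z with
    | zero => simp
    | tmul b a =>
      simp [Algebra.ofId_apply, ← Algebra.smul_def]
    | add x y hx hy => simp [hx, hy]
  refine (Algebra.TensorProduct.basis B bA).ext_elem fun i ↦ ?_
  rw [map_zero, Finsupp.zero_apply]
  exact hS _ fun s hs ↦ by simp [key, hz s hs]

namespace AlgebraicGeometry

/-- Two morphisms from an affine scheme over `S` to a separated `S`-scheme agree if they agree on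
a family of points which is jointly injective on global sections. -/
theorem ext_of_jointly_injective {ι : Type*} {C : CommRingCat.{u}} {Y S : Scheme.{u}}
    {D : ι → CommRingCat.{u}} (σ : ∀ i, C ⟶ D i)
    (hσ : ∀ c : C, (∀ i, σ i c = 0) → c = 0) (f : Y ⟶ S) [IsSeparated f]
    (a b : Spec C ⟶ Y) (hf : a ≫ f = b ≫ f)
    (hab : ∀ i, Spec.map (σ i) ≫ a = Spec.map (σ i) ≫ b) : a = b := by
  let X' : Over S := Over.mk (a ≫ f)
  let Y' : Over S := Over.mk f
  let a' : X' ⟶ Y' := Over.homMk a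
  let b' : X' ⟶ Y' := Over.homMk b
  have : IsSeparated Y'.hom := ‹_›
  let e : (equalizer a' b').left ⟶ Spec C := (equalizer.ι a' b').left
  have he : IsClosedImmersion e := isClosedImmersion_equalizer_ι_left a' b'
  have hl (i) : ∃ l, l ≫ e = Spec.map (σ i) := by
    let U : Over S := Over.mk (Spec.map (σ i) ≫ a ≫ f)
    let j : U ⟶ X' := Over.homMk (Spec.map (σ i))
    have hj : j ≫ a' = j ≫ b' := by ext1; exact hab i
    exact ⟨(equalizer.lift j hj).left, by rw [← Over.comp_left, equalizer.lift_ι]; rfl⟩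
  have : IsIso e := by
    refine IsClosedImmersion.isIso_of_injective_of_isAffine
      ((injective_iff_map_eq_zero e.appTop.hom).2 fun x hx ↦ ?_)
    obtain ⟨c, rfl⟩ := (ConcreteCategory.bijective_of_isIso (Scheme.ΓSpecIso C).inv).2 x
    suffices c = 0 by rw [this, map_zero]
    refine hσ c fun i ↦ ?_
    obtain ⟨l, hl⟩ := hl i
    apply (ConcreteCategory.bijective_of_isIso (Scheme.ΓSpecIso (D i)).inv).1
    have h1 : (Scheme.ΓSpecIso C).inv ≫ e.appTop ≫ l.appTop =
        σ i ≫ (Scheme.ΓSpecIso (D i)).inv := by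
      rw [← Scheme.Hom.comp_appTop, hl, Scheme.ΓSpecIso_inv_naturality]
    have h2 := congr($h1 c)
    rw [map_zero]
    refine h2.symm.trans ?_
    exact (congrArg l.appTop.hom hx).trans (map_zero _)
  rw [← cancel_epi e]
  exact congr($(equalizer.condition a' b').left)

theorem ext_of_jointly_injective_algHom {k A B : Type u} [Field k] [CommRing A] [CommRing B]
    [Algebra k A] [Algebra k B] (S : Set (B →ₐ[k] k))
    (hS : ∀ b : B, (∀ s ∈ S, s b = 0) → b = 0) {P Y : Scheme.{u}}
    {p : P ⟶ Spec (.of B)} {q : P ⟶ Spec (.of A)}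
    (H : IsPullback p q (Spec.map (CommRingCat.ofHom (algebraMap k B)))
      (Spec.map (CommRingCat.ofHom (algebraMap k A))))
    (f : Y ⟶ Spec (.of k)) [IsSeparated f] (a b : P ⟶ Y) (hf : a ≫ f = b ≫ f)
    (hab : ∀ s ∈ S, ∀ σ : Spec (.of A) ⟶ P,
      σ ≫ p = Spec.map (CommRingCat.ofHom (algebraMap k A)) ≫
        Spec.map (CommRingCat.ofHom (s : B →+* k)) →
      σ ≫ q = 𝟙 _ → σ ≫ a = σ ≫ b) : a = b := by
  let e := (isPullback_SpecMap_of_isPushout _ _ _ _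
    (CommRingCat.isPushout_tensorProduct k B A)).isoIsPullback _ _ H
  have he₁ : e.hom ≫ p = _ := IsPullback.isoIsPullback_hom_fst ..
  have he₂ : e.hom ≫ q = _ := IsPullback.isoIsPullback_hom_snd ..
  rw [← cancel_epi e.hom]
  refine ext_of_jointly_injective (D := fun _ : S ↦ .of A)
    (fun s ↦ CommRingCat.ofHom (Algebra.TensorProduct.lift ((Algebra.ofId k A).comp s.1)
      (AlgHom.id k A) (fun _ _ ↦ .all _ _)).toRingHom) ?_ f _ _ (by simp [hf]) ?_
  · exact fun z hz ↦ tensorProduct_eq_zero_of_forall_lift_eq_zero S hS z fun s hs ↦ hz ⟨s, hs⟩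
  · intro s
    rw [← Category.assoc, ← Category.assoc]
    apply hab s.1 s.2
    · rw [Category.assoc, he₁, ← Spec.map_comp, ← Spec.map_comp, ← CommRingCat.ofHom_comp,
        ← CommRingCat.ofHom_comp]
      congr 2
      ext x
      simp [Algebra.ofId_apply]
    · rw [Category.assoc, he₂, ← Spec.map_comp, ← CommRingCat.ofHom_comp, ← Spec.map_id]
      congr 1
      ext x
      simp

theorem eq_zero_of_dense_points {k B : Type u} [Field k] [CommRing B] [Algebra k B]
    {X : Scheme.{u}} [IsReduced X] {fX : X ⟶ Spec (.of k)} (Sig : Set (Spec (.of k) ⟶ X))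
    (hSig : ∀ s ∈ Sig, s ≫ fX = 𝟙 _) (hdense : Dense (⋃ s ∈ Sig, Set.range s))
    (j : Spec (.of B) ⟶ X) [IsOpenImmersion j]
    (hj : j ≫ fX = Spec.map (CommRingCat.ofHom (algebraMap k B))) (b : B)
    (hb : ∀ s : B →ₐ[k] k, Spec.map (CommRingCat.ofHom (s : B →+* k)) ≫ j ∈ Sig → s b = 0) :
    b = 0 := by
  have : IsReduced (Spec (.of B)) := isReduced_of_isOpenImmersion j
  have : _root_.IsReduced B := (affine_isReduced_iff (.of B)).1 this
  by_contra h
  have hne : ((PrimeSpectrum.basicOpen b : Set (PrimeSpectrum B))).Nonempty := by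
    rw [Set.nonempty_iff_ne_empty]
    intro h0
    refine h (IsReduced.eq_zero b ((PrimeSpectrum.basicOpen_eq_bot_iff b).1 ?_))
    exact SetLike.coe_injective h0
  have hopen : IsOpen (j '' (PrimeSpectrum.basicOpen b : Set (PrimeSpectrum B))) :=
    j.isOpenEmbedding.isOpenMap _ (PrimeSpectrum.basicOpen b).isOpen
  obtain ⟨_, ⟨y, hy, rfl⟩, hx⟩ := hdense.inter_open_nonempty _ hopen (hne.image _)
  simp only [Set.mem_iUnion] at hx
  obtain ⟨s, hs, t, ht⟩ := hx
  have hrange : Set.range s ⊆ Set.range j := by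
    rintro _ ⟨t', rfl⟩
    exact ⟨y, by rw [← ht, Subsingleton.elim t t']⟩
  let s' := IsOpenImmersion.lift j s hrange
  have hs' : s' ≫ j = s := IsOpenImmersion.lift_fac _ _ _
  obtain ⟨ψ, hψ⟩ := Spec.map_surjective s'
  have hψk : CommRingCat.ofHom (algebraMap k B) ≫ ψ = 𝟙 _ := by
    apply Spec.map_injective
    rw [Spec.map_comp, hψ, ← hj, ← Category.assoc, hs', hSig s hs, Spec.map_id]
  let ψ' : B →ₐ[k] k := { ψ.hom with commutes' := fun r ↦ congr($hψk r) }
  have hψ' : Spec.map (CommRingCat.ofHom (ψ' : B →+* k)) = s' := hψ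
  have hzero : ψ b = 0 := hb ψ' (by rwa [hψ', hs'])
  have hy' : s' t = y := j.isOpenEmbedding.injective (by rw [← ht, ← hs']; rfl)
  rw [← hy', ← hψ] at hy
  have hmem : ψ.hom b ∉ PrimeSpectrum.asIdeal t := hy
  exact hmem (by rw [show ψ.hom b = 0 from hzero]; exact zero_mem _)

theorem fst_comp_eq_of_dense_points {k A B : Type u} [Field k] [CommRing A] [Algebra k A]
    [CommRing B] {X P Y : Scheme.{u}} [IsReduced X] {fX : X ⟶ Spec (.of k)}
    {p : P ⟶ X} {q : P ⟶ Spec (.of A)}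
    (H : IsPullback p q fX (Spec.map (CommRingCat.ofHom (algebraMap k A))))
    (Sig : Set (Spec (.of k) ⟶ X)) (hSig : ∀ s ∈ Sig, s ≫ fX = 𝟙 _)
    (hdense : Dense (⋃ s ∈ Sig, Set.range s))
    (f : Y ⟶ Spec (.of k)) [IsSeparated f] (a b : P ⟶ Y) (hf : a ≫ f = b ≫ f)
    (hab : ∀ s ∈ Sig, ∀ σ : Spec (.of A) ⟶ P,
      σ ≫ p = Spec.map (CommRingCat.ofHom (algebraMap k A)) ≫ s →
      σ ≫ q = 𝟙 _ → σ ≫ a = σ ≫ b)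
    (j : Spec (.of B) ⟶ X) (h_open : IsOpenImmersion j) :
    pullback.fst p j ≫ a = pullback.fst p j ≫ b := by
  obtain ⟨φ, hφ⟩ := Spec.map_surjective (j ≫ fX)
  let : Algebra k B := φ.hom.toAlgebra
  have hj : j ≫ fX = Spec.map (CommRingCat.ofHom (algebraMap k B)) := hφ.symm
  have H' := (IsPullback.of_hasPullback p j).flip.paste_vert H
  rw [hj] at H'
  refine ext_of_jointly_injective_algHom
    {s : B →ₐ[k] k | Spec.map (CommRingCat.ofHom (s : B →+* k)) ≫ j ∈ Sig}
    (eq_zero_of_dense_points Sig hSig hdense j hj) H' f _ _ (by simp [hf]) ?_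
  intro s hs σ h₁ h₂
  rw [← Category.assoc, ← Category.assoc]
  refine hab _ hs _ ?_ (by rw [Category.assoc, h₂])
  rw [Category.assoc, pullback.condition, reassoc_of% h₁]

/-- Let `X` be a reduced `k`-scheme with a dense set `Sig` of `k`-points and `P = X ×ₖ Spec A`.
Two `k`-morphisms from `P` to a separated `k`-scheme agree if they agree on the `A`-points induced
by `Sig`. -/
theorem ext_of_dense_points {k A : Type u} [Field k] [CommRing A] [Algebra k A]
    {X P Y : Scheme.{u}} [IsReduced X] {fX : X ⟶ Spec (.of k)}
    {p : P ⟶ X} {q : P ⟶ Spec (.of A)}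
    (H : IsPullback p q fX (Spec.map (CommRingCat.ofHom (algebraMap k A))))
    (Sig : Set (Spec (.of k) ⟶ X)) (hSig : ∀ s ∈ Sig, s ≫ fX = 𝟙 _)
    (hdense : Dense (⋃ s ∈ Sig, Set.range s))
    (f : Y ⟶ Spec (.of k)) [IsSeparated f] (a b : P ⟶ Y) (hf : a ≫ f = b ≫ f)
    (hab : ∀ s ∈ Sig, ∀ σ : Spec (.of A) ⟶ P,
      σ ≫ p = Spec.map (CommRingCat.ofHom (algebraMap k A)) ≫ s →
      σ ≫ q = 𝟙 _ → σ ≫ a = σ ≫ b) : a = b := by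
  refine Scheme.Cover.hom_ext (X.affineCover.pullback₁ p) _ _ fun i ↦ ?_
  exact fst_comp_eq_of_dense_points H Sig hSig hdense f a b hf hab (X.affineCover.f i)
    (X.affineCover.map_prop i)

end AlgebraicGeometry

/-- Let `k` be a field and `R` a nonzero commutative `k`-algebra. Let `X`, `Y` be
schemes of finite type over `k` with `X` reduced and `Y` separated over `k`, and let
`Sig` be a Zariski-dense set of `k`-points of `X`. A morphism of `R`-schemes
`φ : X_R ⟶ Y_R` arises by base change from a morphism of `k`-schemes `X ⟶ Y` if and
only if, for every `s ∈ Sig`, the `R`-point `φ ∘ s_R` of `Y_R` arises by base change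
from a `k`-point of `Y`. -/
theorem descend_morphism_iff_of_dense_points
    (k R : Type u) [Field k] [CommRing R] [Nontrivial R] [Algebra k R]
    (X Y : Scheme.{u})
    (fX : X ⟶ Spec (CommRingCat.of k)) (fY : Y ⟶ Spec (CommRingCat.of k))
    [IsReduced X]
    [LocallyOfFiniteType fX] [QuasiCompact fX]
    [LocallyOfFiniteType fY] [QuasiCompact fY]
    [IsSeparated fY]
    (g : Spec (CommRingCat.of R) ⟶ Spec (CommRingCat.of k))
    (hg : g = Spec.map (CommRingCat.ofHom (algebraMap k R)))
    (Sig : Set (Spec (CommRingCat.of k) ⟶ X))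
    (hSig : ∀ s ∈ Sig, s ≫ fX = 𝟙 _)
    (hdense : Dense (⋃ s ∈ Sig, Set.range s.base))
    (φ : pullback fX g ⟶ pullback fY g)
    (hφ : φ ≫ pullback.snd fY g = pullback.snd fX g) :
    (∃ (ψ : X ⟶ Y) (hψ : ψ ≫ fY = fX),
        φ = pullback.map fX g fY g ψ (𝟙 _) (𝟙 _)
              (by rw [Category.comp_id, hψ]) (by simp)) ↔
    (∀ s : Spec (CommRingCat.of k) ⟶ X, ∀ hs : s ∈ Sig,
      ∃ (t : Spec (CommRingCat.of k) ⟶ Y) (ht : t ≫ fY = 𝟙 _),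
        pullback.lift (g ≫ s) (𝟙 _)
            (by rw [Category.assoc, hSig s hs, Category.comp_id, Category.id_comp]) ≫ φ
          = pullback.lift (g ≫ t) (𝟙 _)
              (by rw [Category.assoc, ht, Category.comp_id, Category.id_comp])) := by
  constructor
  · rintro ⟨ψ, hψ, rfl⟩ s hs
    refine ⟨s ≫ ψ, by rw [Category.assoc, hψ, hSig s hs], ?_⟩
    ext1
    · rw [Category.assoc, pullback.map, pullback.lift_fst, pullback.lift_fst_assoc,
        pullback.lift_fst, Category.assoc]
    · rw [Category.assoc, pullback.map, pullback.lift_snd, pullback.lift_snd_assoc,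
        pullback.lift_snd, Category.comp_id]
  · intro h
    have hflat : Flat g := by
      rw [hg, Flat.SpecMap_iff, CommRingCat.hom_ofHom, RingHom.flat_algebraMap_iff]
      infer_instance
    have hsurj : Surjective g := ⟨fun x ↦ by
      obtain ⟨y⟩ : Nonempty (Spec (CommRingCat.of R)) := inferInstance
      exact ⟨y, Subsingleton.elim _ _⟩⟩
    have hqc : QuasiCompact g := by
      rw [hg]
      infer_instance
    let p := pullback.fst fX g
    let q := pullback.snd fX g
    let e := φ ≫ pullback.fst fY g
    have he : e ≫ fY = p ≫ fX := by
      simp only [e, p, Category.assoc, pullback.condition, reassoc_of% hφ]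
    have key : pullback.fst p p ≫ e = pullback.snd p p ≫ e := by
      have hT := isPullback_SpecMap_of_isPushout _ _ _ _
        (CommRingCat.isPushout_tensorProduct k R R)
      rw [← hg] at hT
      generalize hi₁ : Spec.map (CommRingCat.ofHom (S := R ⊗[k] R)
        Algebra.TensorProduct.includeLeftRingHom) = i₁ at hT
      generalize Spec.map _ = i₂ at hT
      have hg' : i₁ ≫ g = Spec.map (CommRingCat.ofHom (algebraMap k (R ⊗[k] R))) := by
        rw [hg, ← hi₁, ← Spec.map_comp]
        rfl
      have hX : IsPullback p q fX g := .of_hasPullback fX g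
      have hP := (IsPullback.of_hasPullback p p).flip.paste_horiz hX.flip
      rw [hX.w] at hP
      obtain ⟨L, hL₁, hL₂, hL⟩ : ∃ L, L ≫ i₁ = pullback.fst p p ≫ q ∧
          L ≫ i₂ = pullback.snd p p ≫ q ∧ IsPullback L (pullback.fst p p) i₁ q :=
        ⟨_, hT.flip.lift_snd _ _ _, hT.flip.lift_fst _ _ _, hP.of_right' hT.flip⟩
      have hL := hL.flip.paste_horiz hX
      rw [hg'] at hL
      refine ext_of_dense_points hL Sig hSig hdense fY _ _ ?_ fun s hs σ h₁ h₂ ↦ ?_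
      · rw [Category.assoc (f := pullback.fst p p), Category.assoc (f := pullback.snd p p), he, pullback.condition_assoc]
      rw [← hg', Category.assoc] at h₁
      obtain ⟨t, ht, hst⟩ := h s hs
      have hst := congr($hst ≫ pullback.fst fY g)
      rw [Category.assoc, pullback.lift_fst] at hst
      have hσ₁ : σ ≫ pullback.fst p p = i₁ ≫ pullback.lift (g ≫ s) (𝟙 _)
          (by rw [Category.assoc, hSig s hs, Category.comp_id, Category.id_comp]) := by
        apply hX.hom_ext
        · rw [Category.assoc, Category.assoc, pullback.lift_fst, h₁]
        · rw [Category.assoc, Category.assoc, pullback.lift_snd, Category.comp_id, ← hL₁,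
            reassoc_of% h₂]
      have hσ₂ : σ ≫ pullback.snd p p = i₂ ≫ pullback.lift (g ≫ s) (𝟙 _)
          (by rw [Category.assoc, hSig s hs, Category.comp_id, Category.id_comp]) := by
        apply hX.hom_ext
        · rw [Category.assoc, Category.assoc, pullback.lift_fst, ← pullback.condition, h₁,
            reassoc_of% hT.w]
        · rw [Category.assoc, Category.assoc, pullback.lift_snd, Category.comp_id, ← hL₂,
            reassoc_of% h₂]
      rw [reassoc_of% hσ₁, reassoc_of% hσ₂, hst, reassoc_of% hT.w]
    have hker {Z : Scheme.{u}} (g₁ g₂ : Z ⟶ pullback fX g) (hg : g₁ ≫ p = g₂ ≫ p) :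
        g₁ ≫ e = g₂ ≫ e := by
      rw [← pullback.lift_fst g₁ g₂ hg, Category.assoc, key, pullback.lift_snd_assoc]
    have hψ : p ≫ EffectiveEpi.desc p e hker = e := EffectiveEpi.fac ..
    refine ⟨EffectiveEpi.desc p e hker, ?_, ?_⟩
    · rw [← cancel_epi p, reassoc_of% hψ, he]
    · ext1
      · rw [pullback.lift_fst]
        exact hψ.symm
      · rw [hφ, pullback.lift_snd, Category.comp_id]
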